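/- (Definable Positivstellensatz, part (i)) Let r be a nonnegative integer and f₁, …, f_k: ℝⁿ → ℝ definable C^r functions such that S = {x ∈ ℝⁿ : f_i(x) ≥ 0 for i = 1, …, k} is nonempty, and let g: ℝⁿ → ℝ be a definable C^r function with g ≥ 0 on S. Then there exist definable C^r functions p, v₀, v₁, …, v_k: ℝⁿ → ℝ such that {x : p(x) = 0} ⊆ {x : g(x) = 0} and p²·g = v₀² + Σ_{i=1}^{k} v_i²·f_i on ℝⁿ. -/

import Mathlib

open FirstOrder Set Topology

namespace Paper

variable (L : FirstOrder.Language) [L.Structure ℝ]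

/-- A subset of `ℝⁿ` is definable in the structure (with parameters from `ℝ`). -/
def Def (n : ℕ) (s : Set (Fin n → ℝ)) : Prop :=
  Set.Definable (Set.univ : Set ℝ) L s

/-- A subset of `ℝ` is definable. -/
def Def1 (s : Set ℝ) : Prop := Def L 1 {x | x 0 ∈ s}

/-- The structure expands the ordered field `(ℝ, <, +, ·, 0, 1)`:
the order and the field operations (and the constants) are definable. -/
def ExpandsOrderedField : Prop :=
  Def L 2 {x | x 0 < x 1} ∧ Def L 3 {x | x 0 + x 1 = x 2} ∧
  Def L 3 {x | x 0 * x 1 = x 2} ∧ Def L 1 {x | x 0 = 0} ∧ Def L 1 {x | x 0 = 1}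

/-- Local o-minimality: every definable subset of `ℝ` is, near each point, a finite
union of points and open intervals. -/
def LocallyOMinimal : Prop :=
  ∀ X : Set ℝ, Def1 L X → ∀ a : ℝ,
    ∃ b c : ℝ, b < a ∧ a < c ∧
      ∃ (P : Finset ℝ) (J : Finset (ℝ × ℝ)),
        X ∩ Set.Ioo b c = ↑P ∪ ⋃ p ∈ J, Set.Ioo p.1 p.2

/-- First component of a point of `ℝ^(m+n) = ℝ^m × ℝ^n`. -/
def fstFun {m n : ℕ} (z : Fin (m + n) → ℝ) : Fin m → ℝ := fun i => z (Fin.castAdd n i)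

/-- Second component of a point of `ℝ^(m+n) = ℝ^m × ℝ^n`. -/
def sndFun {m n : ℕ} (z : Fin (m + n) → ℝ) : Fin n → ℝ := fun j => z (Fin.natAdd m j)

/-- The map `f : X → ℝⁿ`, `X ⊆ ℝ^m`, is definable (its graph over `X` is definable). -/
def DefMapOn (m n : ℕ) (X : Set (Fin m → ℝ)) (f : (Fin m → ℝ) → (Fin n → ℝ)) : Prop :=
  Def L (m + n) {z | fstFun z ∈ X ∧ sndFun z = f (fstFun z)}

/-- The function `f : X → ℝ`, `X ⊆ ℝ^m`, is definable. -/
def DefFunOn (m : ℕ) (X : Set (Fin m → ℝ)) (f : (Fin m → ℝ) → ℝ) : Prop :=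
  DefMapOn L m 1 X fun x _ => f x

/-- `f` is of class `C^r` on `X` in the sense that near every point of `X` it agrees on `X`
with a `C^r` map defined on an open neighborhood in the ambient space. -/
def CrMapOn (r m n : ℕ) (X : Set (Fin m → ℝ)) (f : (Fin m → ℝ) → (Fin n → ℝ)) : Prop :=
  ∀ a ∈ X, ∃ (W : Set (Fin m → ℝ)) (g : (Fin m → ℝ) → (Fin n → ℝ)),
    a ∈ W ∧ IsOpen W ∧ ContDiffOn ℝ r g W ∧ Set.EqOn f g (X ∩ W)

/-- Real-valued version of `CrMapOn`. -/
def CrFunOn (r m : ℕ) (X : Set (Fin m → ℝ)) (f : (Fin m → ℝ) → ℝ) : Prop :=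
  ∀ a ∈ X, ∃ (W : Set (Fin m → ℝ)) (g : (Fin m → ℝ) → ℝ),
    a ∈ W ∧ IsOpen W ∧ ContDiffOn ℝ r g W ∧ Set.EqOn f g (X ∩ W)

/-- A definable `C^r` map `X → ℝⁿ`. -/
def DefCrMapOn (r m n : ℕ) (X : Set (Fin m → ℝ)) (f : (Fin m → ℝ) → (Fin n → ℝ)) : Prop :=
  DefMapOn L m n X f ∧ CrMapOn r m n X f

/-- A definable `C^r` function `X → ℝ`. -/
def DefCrFunOn (r m : ℕ) (X : Set (Fin m → ℝ)) (f : (Fin m → ℝ) → ℝ) : Prop :=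
  DefFunOn L m X f ∧ CrFunOn r m X f

/-- A definable `C^r` submanifold of `ℝⁿ` of dimension `d`: around every point there is a
definable `C^r` chart of `ℝⁿ` straightening `M` to the first `d` coordinates. -/
def IsDefCrSubmanifold (r n d : ℕ) (M : Set (Fin n → ℝ)) : Prop :=
  Def L n M ∧
  ∀ a ∈ M, ∃ (U V : Set (Fin n → ℝ)) (φ ψ : (Fin n → ℝ) → (Fin n → ℝ)),
    a ∈ U ∧ IsOpen U ∧ Def L n U ∧
    (0 : Fin n → ℝ) ∈ V ∧ IsOpen V ∧ Def L n V ∧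
    DefMapOn L n n U φ ∧ DefMapOn L n n V ψ ∧
    ContDiffOn ℝ r φ U ∧ ContDiffOn ℝ r ψ V ∧
    Set.BijOn φ U V ∧ Set.InvOn ψ φ U V ∧
    φ a = 0 ∧
    φ '' (M ∩ U) = {x ∈ V | ∀ i : Fin n, d ≤ (i : ℕ) → x i = 0}

/-- The Euclidean norm on `ℝⁿ`. -/
noncomputable def eunorm {n : ℕ} (x : Fin n → ℝ) : ℝ := Real.sqrt (∑ i, x i ^ 2)

/-- Projection of `ℝⁿ` onto the `d` coordinates selected by `σ`. -/
def coordProj {n : ℕ} (d : ℕ) (σ : Fin d → Fin n) (x : Fin n → ℝ) : Fin d → ℝ :=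
  fun i => x (σ i)

/-- `X ⊆ ℝⁿ` has dimension `d`: `d` is the largest integer such that some coordinate
projection of `X` onto `ℝ^d` has nonempty interior. -/
def HasDim {n : ℕ} (X : Set (Fin n → ℝ)) (d : ℕ) : Prop :=
  (∃ σ : Fin d → Fin n, Function.Injective σ ∧ (interior (coordProj d σ '' X)).Nonempty) ∧
  ∀ (e : ℕ) (σ : Fin e → Fin n), Function.Injective σ →
    (interior (coordProj e σ '' X)).Nonempty → e ≤ d

/-- A (bounded) open box in `ℝⁿ`. -/
def IsOpenBox {n : ℕ} (B : Set (Fin n → ℝ)) : Prop :=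
  ∃ a b : Fin n → ℝ, (∀ i, a i < b i) ∧ B = Set.pi Set.univ fun i => Set.Ioo (a i) (b i)


/-- A function `ℝⁿ → ℝ` is definable iff its graph, with the value as a last coordinate, is. -/
theorem defFunOn_univ_iff {n : ℕ} {f : (Fin n → ℝ) → ℝ} :
    DefFunOn L n Set.univ f ↔
      Def L (n + 1) {z | f (fun i => z (Fin.castAdd 1 i)) = z (Fin.natAdd n 0)} := by
  unfold DefFunOn DefMapOn
  have h : {z : Fin (n + 1) → ℝ | fstFun z ∈ Set.univ ∧ sndFun z = fun _ => f (fstFun z)} =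
      {z | f (fun i => z (Fin.castAdd 1 i)) = z (Fin.natAdd n 0)} := by
    ext z
    simp only [Set.mem_univ, true_and, Set.mem_ofPred_eq]
    constructor
    · intro h
      exact (congrFun h 0).symm
    · intro h
      funext j
      rw [Subsingleton.elim j 0]
      exact h.symm
  rw [h]

section Definability

variable {L} {n : ℕ}

theorem DefFunOn.comp₂ {op : ℝ → ℝ → ℝ} (hop : Def L 3 {x | op (x 0) (x 1) = x 2})
    {f g : (Fin n → ℝ) → ℝ} (hf : DefFunOn L n Set.univ f) (hg : DefFunOn L n Set.univ g) :
    DefFunOn L n Set.univ (fun x => op (f x) (g x)) := by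
  rw [defFunOn_univ_iff] at *
  unfold Def at *
  let φ (j : Fin 2) : Fin (n + 1) → Fin (n + 1) ⊕ Fin 2 :=
    Fin.addCases (fun i => Sum.inl (Fin.castAdd 1 i)) (fun _ => Sum.inr j)
  have hF := hf.preimage_comp (φ 0)
  have hG := hg.preimage_comp (φ 1)
  have hO := hop.preimage_comp
    (![Sum.inr 0, Sum.inr 1, Sum.inl (Fin.natAdd n 0)] : Fin 3 → Fin (n + 1) ⊕ Fin 2)
  convert ((hF.inter hG).inter hO).image_comp (Sum.inl : Fin (n + 1) → Fin (n + 1) ⊕ Fin 2)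
    using 1
  ext z
  simp only [Set.mem_ofPred_eq, Set.mem_image, Set.mem_inter_iff, Set.mem_preimage,
    Function.comp_apply, φ, Fin.addCases_left, Fin.addCases_right]
  constructor
  · intro h
    refine ⟨Sum.elim z ![f fun i => z (Fin.castAdd 1 i), g fun i => z (Fin.castAdd 1 i)], ?_, ?_⟩
    · simpa using h
    · funext i
      simp
  · rintro ⟨w, ⟨⟨hf, hg⟩, hop⟩, rfl⟩
    simp at hop
    simp [hf, hg, hop]

theorem DefFunOn.const_of_def {c : ℝ} (hc : Def L 1 {x | x 0 = c}) :
    DefFunOn L n Set.univ (fun _ => c) := by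
  rw [defFunOn_univ_iff]
  unfold Def at *
  convert hc.preimage_comp (fun _ => Fin.natAdd n 0 : Fin 1 → Fin (n + 1)) using 1
  ext z
  simp [eq_comm]

theorem ExpandsOrderedField.def_sub (h : ExpandsOrderedField L) :
    Def L 3 {x | x 0 - x 1 = x 2} := by
  have hadd := h.2.1
  unfold Def at *
  convert hadd.preimage_comp (![2, 1, 0] : Fin 3 → Fin 3) using 1
  ext z
  simp only [Set.mem_ofPred_eq, Set.mem_preimage, Function.comp_apply, Matrix.cons_val]
  constructor <;> intro h <;> linarith

theorem ExpandsOrderedField.def_nonneg (h : ExpandsOrderedField L) :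
    Def L 1 {x | 0 ≤ x 0} := by
  have hmul := h.2.2.1
  unfold Def at *
  have hsq := hmul.preimage_comp (![1, 1, 0] : Fin 3 → Fin 2)
  convert hsq.image_comp (![0] : Fin 1 → Fin 2) using 1
  ext z
  simp only [Set.mem_ofPred_eq, Set.mem_preimage, Set.mem_image, Function.comp_apply,
    Matrix.cons_val]
  constructor
  · intro h
    refine ⟨![z 0, √(z 0)], by simp [h], ?_⟩
    funext i
    simp [Subsingleton.elim i 0]
  · rintro ⟨w, hw, rfl⟩
    simp only [Function.comp_apply, Matrix.cons_val]
    nlinarith [mul_self_nonneg (w 1)]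

/-- The square root is definable; it is stated as a binary operation, the second argument being
ignored, so that it can be used with `DefFunOn.comp₂`. -/
theorem ExpandsOrderedField.def_sqrt (h : ExpandsOrderedField L) :
    Def L 3 {x | √(x 0) = x 2} := by
  have hmul := h.2.2.1
  have hzero := h.2.2.2.1
  have hnn := h.def_nonneg
  unfold Def at *
  have hsq := hmul.preimage_comp (![2, 2, 0] : Fin 3 → Fin 3)
  have hv := hnn.preimage_comp (![2] : Fin 1 → Fin 3)
  have ha := hnn.preimage_comp (![0] : Fin 1 → Fin 3)
  have hz := hzero.preimage_comp (![2] : Fin 1 → Fin 3)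
  convert (hsq.inter hv).union (ha.compl.inter hz) using 1
  ext z
  simp only [Set.mem_ofPred_eq, Set.mem_preimage, Set.mem_union, Set.mem_inter_iff,
    Set.mem_compl_iff, Function.comp_apply, Matrix.cons_val, not_le]
  constructor
  · intro h
    rcases le_or_gt 0 (z 0) with h0 | h0
    · left
      rw [← h]
      exact ⟨Real.mul_self_sqrt h0, Real.sqrt_nonneg _⟩
    · right
      exact ⟨h0, by rw [← h, Real.sqrt_eq_zero_of_nonpos h0.le]⟩
  · rintro (⟨h1, h2⟩ | ⟨h1, h2⟩)
    · rw [← h1, Real.sqrt_mul_self h2]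
    · rw [h2, Real.sqrt_eq_zero_of_nonpos h1.le]

variable {f g : (Fin n → ℝ) → ℝ}

theorem DefFunOn.add (h : ExpandsOrderedField L) (hf : DefFunOn L n Set.univ f)
    (hg : DefFunOn L n Set.univ g) : DefFunOn L n Set.univ (fun x => f x + g x) :=
  hf.comp₂ h.2.1 hg

theorem DefFunOn.mul (h : ExpandsOrderedField L) (hf : DefFunOn L n Set.univ f)
    (hg : DefFunOn L n Set.univ g) : DefFunOn L n Set.univ (fun x => f x * g x) :=
  hf.comp₂ h.2.2.1 hg

theorem DefFunOn.neg (h : ExpandsOrderedField L) (hf : DefFunOn L n Set.univ f) :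
    DefFunOn L n Set.univ (fun x => -f x) := by
  simpa using (DefFunOn.const_of_def h.2.2.2.1).comp₂ h.def_sub hf

theorem DefFunOn.sqrt (h : ExpandsOrderedField L) (hf : DefFunOn L n Set.univ f) :
    DefFunOn L n Set.univ (fun x => √(f x)) :=
  hf.comp₂ (op := fun a _ => √a) h.def_sqrt hf

theorem DefFunOn.pow (h : ExpandsOrderedField L) (hf : DefFunOn L n Set.univ f) (m : ℕ) :
    DefFunOn L n Set.univ (fun x => f x ^ m) := by
  induction m with
  | zero => simpa using DefFunOn.const_of_def h.2.2.2.2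
  | succ m ih => simpa only [pow_succ] using ih.mul h hf

theorem DefFunOn.sum (h : ExpandsOrderedField L) {ι : Type*} (s : Finset ι)
    {F : ι → (Fin n → ℝ) → ℝ} (hF : ∀ i, DefFunOn L n Set.univ (F i)) :
    DefFunOn L n Set.univ (fun x => ∑ i ∈ s, F i x) := by
  classical
  induction s using Finset.induction_on with
  | empty => simpa using DefFunOn.const_of_def h.2.2.2.1
  | insert i s hi ih => simpa only [Finset.sum_insert hi] using (hF i).add h ih

end Definability

/-- The formula also holds for `x ≤ 0`, where `√x = 0` by convention. -/
theorem hasDerivAt_sqrt_pow (m : ℕ) (x : ℝ) :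
    HasDerivAt (fun y : ℝ => √y ^ (m + 3)) ((m + 3) / 2 * √x ^ (m + 1)) x := by
  rcases lt_trichotomy x 0 with hx | rfl | hx
  · rw [Real.sqrt_eq_zero_of_nonpos hx.le, zero_pow (by lia), mul_zero]
    refine (hasDerivAt_const x (0 : ℝ)).congr_of_eventuallyEq ?_
    filter_upwards [Iio_mem_nhds hx] with y hy
    rw [Real.sqrt_eq_zero_of_nonpos (le_of_lt hy), zero_pow (by lia)]
  · rw [Real.sqrt_zero, zero_pow (by lia), mul_zero, hasDerivAt_iff_tendsto_slope_zero]
    have h : Filter.Tendsto (fun t : ℝ => √t ^ (m + 1)) (𝓝[≠] 0) (𝓝 0) := by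
      have hc : Continuous fun t : ℝ => √t ^ (m + 1) := by fun_prop
      simpa using (hc.tendsto 0).mono_left nhdsWithin_le_nhds
    refine h.congr' ?_
    filter_upwards [self_mem_nhdsWithin] with t ht
    simp only [zero_add, Real.sqrt_zero, smul_eq_mul]
    rw [zero_pow (by lia), sub_zero]
    rcases le_or_gt t 0 with h0 | h0
    · rw [Real.sqrt_eq_zero_of_nonpos h0, zero_pow (by lia), zero_pow (by lia), mul_zero]
    · rw [show m + 3 = (m + 1) + 2 by lia, pow_add √t (m + 1) 2, Real.sq_sqrt h0.le]
      field_simp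
  · refine ((Real.hasDerivAt_sqrt hx.ne').pow (m + 3)).congr_deriv ?_
    have : √x ≠ 0 := (Real.sqrt_pos.2 hx).ne'
    push_cast
    rw [show m + 2 = (m + 1) + 1 by lia, pow_succ √x (m + 1)]
    field_simp

/-- With Mathlib's convention `√x = 0` for `x ≤ 0`, the power `√x ^ m` is of class `C^r` on all
of `ℝ` as soon as `m > 2 r`. -/
theorem contDiff_sqrt_pow (r : ℕ) {m : ℕ} (hm : 2 * r < m) :
    ContDiff ℝ r (fun y : ℝ => √y ^ m) := by
  induction r generalizing m with
  | zero => exact contDiff_zero.2 (by fun_prop)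
  | succ r ih =>
    obtain ⟨l, rfl⟩ : ∃ l, m = l + 3 := ⟨m - 3, by lia⟩
    push_cast
    rw [contDiff_succ_iff_deriv]
    refine ⟨fun x => (hasDerivAt_sqrt_pow l x).differentiableAt, by simp, ?_⟩
    rw [funext fun x => (hasDerivAt_sqrt_pow l x).deriv]
    exact contDiff_const.mul (ih (by lia))

theorem sqrt_pow_sq_mul_self_of_neg (y : ℝ) {m : ℕ} (hm : m ≠ 0) :
    (√(-y) ^ m) ^ 2 * y = -√(-y) ^ (2 * m + 2) := by
  rcases le_total y 0 with h | h
  · have hs := Real.sq_sqrt (neg_nonneg.2 h)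
    rw [pow_add, hs]
    ring
  · simp [Real.sqrt_eq_zero_of_nonpos (neg_nonpos.2 h), hm]

/-- definable Positivstellensatz, part (i). -/
theorem statement4
    (hfield : ExpandsOrderedField L) (hlom : LocallyOMinimal L)
    (r n k : ℕ) (f : Fin k → (Fin n → ℝ) → ℝ)
    (hfdef : ∀ i, DefFunOn L n Set.univ (f i)) (hfC : ∀ i, ContDiff ℝ r (f i))
    (S : Set (Fin n → ℝ)) (hS : S = {x | ∀ i, 0 ≤ f i x}) (hSne : S.Nonempty)
    (g : (Fin n → ℝ) → ℝ) (hgdef : DefFunOn L n Set.univ g) (hgC : ContDiff ℝ r g)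
    (hgS : ∀ x ∈ S, 0 ≤ g x) :
    ∃ (p v₀ : (Fin n → ℝ) → ℝ) (v : Fin k → (Fin n → ℝ) → ℝ),
      DefFunOn L n Set.univ p ∧ ContDiff ℝ r p ∧
      DefFunOn L n Set.univ v₀ ∧ ContDiff ℝ r v₀ ∧
      (∀ i, DefFunOn L n Set.univ (v i) ∧ ContDiff ℝ r (v i)) ∧
      (∀ x, p x = 0 → g x = 0) ∧
      ∀ x, (p x) ^ 2 * g x = (v₀ x) ^ 2 + ∑ i, (v i x) ^ 2 * f i x := by
  let N := 2 * r + 1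
  let H : (Fin n → ℝ) → ℝ := fun x => ∑ i, √(-f i x) ^ (2 * N + 2)
  have hHnn (x) : 0 ≤ H x := Finset.sum_nonneg fun i _ => by positivity
  have hHpos (x) (hx : g x < 0) : 0 < H x := by
    have hxS : ¬ x ∈ S := fun h => absurd (hgS x h) (not_le.2 hx)
    rw [hS, Set.mem_ofPred_eq, not_forall] at hxS
    obtain ⟨i, hi⟩ := hxS
    refine Finset.sum_pos' (fun i _ => by positivity) ⟨i, Finset.mem_univ i, ?_⟩
    have := Real.sqrt_pos.2 (neg_pos.2 (not_le.1 hi))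
    positivity
  have hsqrtC {F : (Fin n → ℝ) → ℝ} (hF : ContDiff ℝ r F) {m : ℕ} (hm : 2 * r < m) :
      ContDiff ℝ r (fun x => √(F x) ^ m) := (contDiff_sqrt_pow r hm).comp hF
  have hHdef : DefFunOn L n Set.univ H :=
    .sum hfield _ fun i => (((hfdef i).neg hfield).sqrt hfield).pow hfield _
  have hHC : ContDiff ℝ r H := ContDiff.sum fun i _ => hsqrtC (hfC i).neg (by lia)
  have hgp := hgdef.sqrt hfield
  have hgm := (hgdef.neg hfield).sqrt hfield
  refine ⟨fun x => √(g x) ^ (N + 1) + √(-g x) ^ (N + 1) * H x ^ (r + 1),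
    fun x => √(g x) ^ (N + 2),
    fun i x => √(-g x) ^ (N + 2) * √(H x) ^ N * √(-f i x) ^ N,
    ?_, ?_, hgp.pow hfield _, hsqrtC hgC (by lia), fun i => ⟨?_, ?_⟩, ?_, ?_⟩
  · exact (hgp.pow hfield _).add hfield ((hgm.pow hfield _).mul hfield (hHdef.pow hfield _))
  · exact (hsqrtC hgC (by lia)).add ((hsqrtC hgC.neg (by lia)).mul (hHC.pow _))
  · exact ((hgm.pow hfield _).mul hfield ((hHdef.sqrt hfield).pow hfield _)).mul hfield
      ((((hfdef i).neg hfield).sqrt hfield).pow hfield _)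
  · exact ((hsqrtC hgC.neg (by lia)).mul (hsqrtC hHC (by lia))).mul
      (hsqrtC (hfC i).neg (by lia))
  · intro x hx
    rcases lt_trichotomy (g x) 0 with h | h | h
    · have h1 := Real.sqrt_pos.2 (neg_pos.2 h)
      have h2 := hHpos x h
      have : 0 < √(g x) ^ (N + 1) + √(-g x) ^ (N + 1) * H x ^ (r + 1) := by positivity
      exact absurd hx this.ne'
    · exact h
    · have h1 := Real.sqrt_pos.2 h
      have h2 := hHnn x
      have : 0 < √(g x) ^ (N + 1) + √(-g x) ^ (N + 1) * H x ^ (r + 1) := by positivity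
      exact absurd hx this.ne'
  · intro x
    have hsum : ∑ i, (√(-g x) ^ (N + 2) * √(H x) ^ N * √(-f i x) ^ N) ^ 2 * f i x =
        -((√(-g x) ^ (N + 2)) ^ 2 * (H x ^ (r + 1)) ^ 2) := by
      have hterm (i) : (√(-g x) ^ (N + 2) * √(H x) ^ N * √(-f i x) ^ N) ^ 2 * f i x =
          -((√(-g x) ^ (N + 2)) ^ 2 * (√(H x) ^ N) ^ 2) * √(-f i x) ^ (2 * N + 2) := by
        linear_combination ((√(-g x) ^ (N + 2)) ^ 2 * (√(H x) ^ N) ^ 2) *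
          sqrt_pow_sq_mul_self_of_neg (f i x) (m := N) (by lia)
      rw [Finset.sum_congr rfl fun i _ => hterm i, ← Finset.mul_sum]
      change -((√(-g x) ^ (N + 2)) ^ 2 * (√(H x) ^ N) ^ 2) * H x = _
      rw [← pow_mul √(H x), mul_comm N 2, pow_mul √(H x), Real.sq_sqrt (hHnn x)]
      ring
    simp only [hsum]
    rcases le_total (g x) 0 with h | h
    · rw [Real.sqrt_eq_zero_of_nonpos h, zero_pow (by lia), zero_pow (by lia),
        pow_succ √(-g x) (N + 1)]
      linear_combination (√(-g x) ^ (N + 1) * H x ^ (r + 1)) ^ 2 * Real.sq_sqrt (neg_nonneg.2 h)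
    · rw [Real.sqrt_eq_zero_of_nonpos (neg_nonpos.2 h), zero_pow (by lia), zero_pow (by lia),
        pow_succ √(g x) (N + 1)]
      linear_combination -(√(g x) ^ (N + 1)) ^ 2 * Real.sq_sqrt h

end Paper
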